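/- arXiv:1211.5804 — 3 statements merged into one kernel-verified Lean document; each statement's English description precedes it below -/
import Mathlib

section
/- Assume the BV function x:[0,T]→ℝ satisfies the weak local stability and the energy-dissipation upper bound. If t ∉ J ∪ int(N∪J) and ∂ₓₓ𝓔(t,x(t)) ≠ 0, then for every sequence tₙ→t with tₙ ∉ J ∪ int(N∪J) and tₙ ≠ t for all n, one has lim_{n→∞} (x(tₙ)−x(t))/(tₙ−t) = − ∂ₓₜ𝓔(t,x(t)) / ∂ₓₓ𝓔(t,x(t)). -/
open Set Filter Topology MeasureTheory

/-- Dissipation of `x` on `[t₁,t₂]`: total variation of `x` on the interval. -/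
noncomputable def Diss (x : ℝ → ℝ) (t₁ t₂ : ℝ) : ℝ :=
  (eVariationOn x (Set.Icc t₁ t₂)).toReal

/-- ∂ₓ𝓔 -/
noncomputable def pEx (E : ℝ → ℝ → ℝ) (t y : ℝ) : ℝ := deriv (fun z => E t z) y
/-- ∂ₜ𝓔 -/
noncomputable def pEt (E : ℝ → ℝ → ℝ) (t y : ℝ) : ℝ := deriv (fun s => E s y) t
/-- ∂ₓₓ𝓔 -/
noncomputable def pExx (E : ℝ → ℝ → ℝ) (t y : ℝ) : ℝ := deriv (fun z => pEx E t z) y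
/-- ∂ₓₓₓ𝓔 -/
noncomputable def pExxx (E : ℝ → ℝ → ℝ) (t y : ℝ) : ℝ := deriv (fun z => pExx E t z) y
/-- ∂ₓₜ𝓔 -/
noncomputable def pExt (E : ℝ → ℝ → ℝ) (t y : ℝ) : ℝ := deriv (fun s => pEx E s y) t
/-- ∂ₓₓₜ𝓔 -/
noncomputable def pExxt (E : ℝ → ℝ → ℝ) (t y : ℝ) : ℝ := deriv (fun s => pExx E s y) t
/-- ∂ₓₜₜ𝓔 -/
noncomputable def pExtt (E : ℝ → ℝ → ℝ) (t y : ℝ) : ℝ := deriv (fun s => pExt E s y) t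

/-- The jump set of `x` on `[0,T]`: points of discontinuity. -/
def JumpSet (x : ℝ → ℝ) (T : ℝ) : Set ℝ :=
  {t ∈ Set.Icc 0 T | ¬ ContinuousWithinAt x (Set.Icc 0 T) t}

/-- N := {t ∈ (0,T) : x'(t) exists and equals 0}. -/
def NullSet (x : ℝ → ℝ) (T : ℝ) : Set ℝ :=
  {t ∈ Set.Ioo 0 T | HasDerivAt x 0 t}

/-- Weak local stability: |∂ₓ𝓔(t,x(t))| ≤ 1 at every continuity point of x in [0,T]. -/
def WeakLS (E : ℝ → ℝ → ℝ) (x : ℝ → ℝ) (T : ℝ) : Prop :=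
  ∀ t ∈ Set.Icc 0 T, ContinuousWithinAt x (Set.Icc 0 T) t → |pEx E t (x t)| ≤ 1

/-- Strong local stability: x(t) local minimizer of z ↦ 𝓔(t,z)+|z−x(t)| off the jump set. -/
def StrongLS (E : ℝ → ℝ → ℝ) (x : ℝ → ℝ) (T : ℝ) : Prop :=
  ∀ t ∈ Set.Icc 0 T \ JumpSet x T, IsLocalMin (fun z => E t z + |z - x t|) (x t)

/-- Energy-dissipation upper bound. -/
def EDUB (E : ℝ → ℝ → ℝ) (x : ℝ → ℝ) (T : ℝ) : Prop :=
  ∀ t₁ t₂ : ℝ, 0 ≤ t₁ → t₁ ≤ t₂ → t₂ ≤ T →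
    E t₂ (x t₂) - E t₁ (x t₁) ≤ (∫ s in t₁..t₂, pEt E s (x s)) - Diss x t₁ t₂

/-- (H1): {(t,x) ∈ (0,T)×ℝ : ∂ₓ𝓔 ∈ {−1,1}, ∂ₓₓ𝓔 = ∂ₓₓₓ𝓔 = 0} is finite. -/
def H1cond (E : ℝ → ℝ → ℝ) (T : ℝ) : Prop :=
  {p : ℝ × ℝ | p.1 ∈ Set.Ioo 0 T ∧ (pEx E p.1 p.2 = -1 ∨ pEx E p.1 p.2 = 1) ∧
    pExx E p.1 p.2 = 0 ∧ pExxx E p.1 p.2 = 0}.Finite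

/-- (H2). -/
def H2cond (E : ℝ → ℝ → ℝ) (T : ℝ) : Prop :=
  {p : ℝ × ℝ | p.1 ∈ Set.Ioo 0 T ∧ (pEx E p.1 p.2 = -1 ∨ pEx E p.1 p.2 = 1) ∧
    pExx E p.1 p.2 = 0 ∧ pExt E p.1 p.2 = 0 ∧
    (pExxt E p.1 p.2) ^ 2 = pExtt E p.1 p.2 * pExxx E p.1 p.2}.Finite

/-- (H3). -/
def H3cond (E : ℝ → ℝ → ℝ) (T : ℝ) : Prop :=
  {p : ℝ × ℝ | p.1 ∈ Set.Ioo 0 T ∧ (pEx E p.1 p.2 = -1 ∨ pEx E p.1 p.2 = 1) ∧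
    pExx E p.1 p.2 = 0 ∧ pExt E p.1 p.2 = 0}.Finite

/-- (H4). -/
def H4cond (E : ℝ → ℝ → ℝ) (T : ℝ) : Prop :=
  {p : ℝ × ℝ | p.1 ∈ Set.Icc 0 T ∧ (pEx E p.1 p.2 = -1 ∨ pEx E p.1 p.2 = 1) ∧
    pExt E p.1 p.2 = 0 ∧ pExtt E p.1 p.2 = 0} = ∅

/-- (H5). -/
def H5cond (E : ℝ → ℝ → ℝ) (T : ℝ) : Prop :=
  {p : ℝ × ℝ | p.1 ∈ Set.Icc 0 T ∧ (pEx E p.1 p.2 = -1 ∨ pEx E p.1 p.2 = 1) ∧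
    pExx E p.1 p.2 = 0} = ∅

theorem hasDerivAt_right_of_uncurry {E : ℝ → ℝ → ℝ} (hE : Differentiable ℝ (Function.uncurry E)) (t y : ℝ) :
    HasDerivAt (fun z => E t z) (fderiv ℝ (Function.uncurry E) (t, y) (0, 1)) y := by
  have h1 : HasDerivAt (fun z : ℝ => (t, z)) ((0 : ℝ), (1 : ℝ)) y :=
    (hasDerivAt_const y t).prodMk (hasDerivAt_id y)
  exact (hE (t, y)).hasFDerivAt.comp_hasDerivAt y h1

theorem hasDerivAt_left_of_uncurry {E : ℝ → ℝ → ℝ} (hE : Differentiable ℝ (Function.uncurry E)) (t y : ℝ) :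
    HasDerivAt (fun s => E s y) (fderiv ℝ (Function.uncurry E) (t, y) (1, 0)) t := by
  have h1 : HasDerivAt (fun s : ℝ => (s, y)) ((1 : ℝ), (0 : ℝ)) t :=
    (hasDerivAt_id t).prodMk (hasDerivAt_const t y)
  exact (hE (t, y)).hasFDerivAt.comp_hasDerivAt t h1

theorem contDiff_pEx {E : ℝ → ℝ → ℝ} (hE : ContDiff ℝ 3 (Function.uncurry E)) :
    ContDiff ℝ 1 (Function.uncurry (pEx E)) := by
  have h : Function.uncurry (pEx E) = fun p => fderiv ℝ (Function.uncurry E) p (0, 1) := by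
    ext ⟨t, y⟩
    exact (hasDerivAt_right_of_uncurry (hE.differentiable (by norm_num)) t y).deriv
  rw [h]
  exact (hE.fderiv_right (m := 1) (by norm_num)).clm_apply contDiff_const

theorem contDiff_pEt {E : ℝ → ℝ → ℝ} (hE : ContDiff ℝ 3 (Function.uncurry E)) :
    ContDiff ℝ 1 (Function.uncurry (pEt E)) := by
  have h : Function.uncurry (pEt E) = fun p => fderiv ℝ (Function.uncurry E) p (1, 0) := by
    ext ⟨t, y⟩
    exact (hasDerivAt_left_of_uncurry (hE.differentiable (by norm_num)) t y).deriv
  rw [h]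
  exact (hE.fderiv_right (m := 1) (by norm_num)).clm_apply contDiff_const

theorem BoundedVariationOn.aemeasurable_restrict_Icc {x : ℝ → ℝ} {a b : ℝ}
    (h : BoundedVariationOn x (Icc a b)) : AEMeasurable x (volume.restrict (Icc a b)) := by
  obtain ⟨p, q, hp, hq, rfl⟩ := h.locallyBoundedVariationOn.exists_monotoneOn_sub_monotoneOn
  exact (aemeasurable_restrict_of_monotoneOn measurableSet_Icc hp).sub
    (aemeasurable_restrict_of_monotoneOn measurableSet_Icc hq)

theorem BoundedVariationOn.abs_sub_le_Diss {x : ℝ → ℝ} {a b s s' : ℝ}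
    (h : BoundedVariationOn x (Icc a b)) (hs : s ∈ Icc a b) (hs' : s' ∈ Icc a b) :
    |x s - x s'| ≤ Diss x a b := by
  rw [← Real.dist_eq]
  exact h.dist_le hs hs'

theorem Diss_nonneg (x : ℝ → ℝ) (a b : ℝ) : 0 ≤ Diss x a b := ENNReal.toReal_nonneg

/-- The power along `x` differs from the power along the frozen state `x a` by at most a Lipschitz
constant times the dissipation. -/
theorem integral_pEt_sub_le {E : ℝ → ℝ → ℝ} (hE : ContDiff ℝ 3 (Function.uncurry E))
    {x : ℝ → ℝ} {a b K : ℝ} (hab : a ≤ b) (hBV : BoundedVariationOn x (Icc a b)) (hK : 0 ≤ K)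
    (hLip : ∀ s ∈ Icc a b, |pEt E s (x s) - pEt E s (x a)| ≤ K * |x s - x a|) :
    (∫ s in a..b, pEt E s (x s)) - (E b (x a) - E a (x a)) ≤ K * Diss x a b * (b - a) := by
  have hcont : Continuous fun s => pEt E s (x a) :=
    (contDiff_pEt hE).continuous.comp (by fun_prop : Continuous fun s : ℝ => (s, x a))
  have hFTC : ∫ s in a..b, pEt E s (x a) = E b (x a) - E a (x a) :=
    intervalIntegral.integral_eq_sub_of_hasDerivAt (f := fun s => E s (x a))
      (fun s _ => ((hasDerivAt_left_of_uncurry (hE.differentiable (by norm_num)) s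
        (x a)).differentiableAt).hasDerivAt)
      (hcont.intervalIntegrable a b)
  have hbound : ∀ s ∈ Icc a b, |pEt E s (x s) - pEt E s (x a)| ≤ K * Diss x a b := fun s hs =>
    (hLip s hs).trans (mul_le_mul_of_nonneg_left
      (hBV.abs_sub_le_Diss hs (left_mem_Icc.2 hab)) hK)
  have hbound' : ∀ s ∈ Set.uIoc a b, ‖pEt E s (x s) - pEt E s (x a)‖ ≤ K * Diss x a b := by
    intro s hs
    rw [uIoc_of_le hab] at hs
    exact hbound s (Ioc_subset_Icc_self hs)
  have hmeas : AEMeasurable (fun s => pEt E s (x s)) (volume.restrict (Icc a b)) :=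
    (contDiff_pEt hE).continuous.measurable.comp_aemeasurable
      (aemeasurable_id.prodMk hBV.aemeasurable_restrict_Icc)
  have hint : IntervalIntegrable (fun s => pEt E s (x s) - pEt E s (x a)) volume a b := by
    rw [intervalIntegrable_iff_integrableOn_Icc_of_le hab]
    refine Integrable.of_bound
      (hmeas.sub hcont.measurable.aemeasurable).aestronglyMeasurable (K * Diss x a b) ?_
    exact (ae_restrict_iff' measurableSet_Icc).2 (Eventually.of_forall hbound)
  have hint' : IntervalIntegrable (fun s => pEt E s (x s)) volume a b := by
    simpa using hint.add (hcont.intervalIntegrable a b)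
  rw [← hFTC, ← intervalIntegral.integral_sub hint' (hcont.intervalIntegrable a b)]
  have h := intervalIntegral.norm_integral_le_of_norm_le_const hbound'
  rw [abs_of_nonneg (sub_nonneg.2 hab)] at h
  exact (le_abs_self _).trans h

theorem Diss_eq_zero_of_abs_pEx_le {E : ℝ → ℝ → ℝ} (hE : ContDiff ℝ 3 (Function.uncurry E))
    {x : ℝ → ℝ} {a b K q : ℝ} (hab : a ≤ b) (hBV : BoundedVariationOn x (Icc a b)) (hK : 0 ≤ K)
    (hq : 0 ≤ q)
    (hED : E b (x b) - E a (x a) ≤ (∫ s in a..b, pEt E s (x s)) - Diss x a b)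
    (hLip : ∀ s ∈ Icc a b, |pEt E s (x s) - pEt E s (x a)| ≤ K * |x s - x a|)
    (hEx : ∀ y ∈ uIcc (x a) (x b), |pEx E b y| ≤ q) (hsmall : K * (b - a) + q < 1) :
    Diss x a b = 0 := by
  have h1 := integral_pEt_sub_le hE hab hBV hK hLip
  have h2 : |E b (x b) - E b (x a)| ≤ q * |x b - x a| :=
    (convex_uIcc (x a) (x b)).norm_image_sub_le_of_norm_deriv_le (f := fun z => E b z)
      (fun y _ => (hasDerivAt_right_of_uncurry (hE.differentiable (by norm_num)) b y).differentiableAt)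
      hEx left_mem_uIcc right_mem_uIcc
  have h3 : q * |x b - x a| ≤ q * Diss x a b := mul_le_mul_of_nonneg_left
    (hBV.abs_sub_le_Diss (right_mem_Icc.2 hab) (left_mem_Icc.2 hab)) hq
  have h4 := (abs_le.1 h2).1
  nlinarith [Diss_nonneg x a b]

/-- Where the stability inequality is strict, `x` is locally constant. -/
theorem exists_const_of_abs_pEx_lt_one {E : ℝ → ℝ → ℝ} {x : ℝ → ℝ} {T t : ℝ}
    (hE : ContDiff ℝ 3 (Function.uncurry E)) (hBV : BoundedVariationOn x (Icc 0 T))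
    (hED : EDUB E x T) (hc : ContinuousWithinAt x (Icc 0 T) t) (hlt : |pEx E t (x t)| < 1) :
    ∃ ε > 0, ∀ a b, a ∈ Icc 0 T → b ∈ Icc 0 T → a ∈ Metric.ball t ε → b ∈ Metric.ball t ε →
      a ≤ b → x a = x b := by
  obtain ⟨q, hq, hq1⟩ := exists_between hlt
  have hq0 : 0 ≤ q := (abs_nonneg _).trans hq.le
  obtain ⟨K, U, hU, hKU⟩ := (contDiff_pEt hE).contDiffAt.exists_lipschitzOnWith (x := (t, x t))
  have hV : ∀ᶠ p in 𝓝 (t, x t), |Function.uncurry (pEx E) p| < q :=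
    (contDiff_pEx hE).continuous.abs.continuousAt.eventually_lt continuousAt_const hq
  obtain ⟨r, hr, hball⟩ := Metric.eventually_nhds_iff_ball.1 ((show ∀ᶠ p in 𝓝 (t, x t), p ∈ U
    from hU).and hV)
  obtain ⟨d, hd, hxd⟩ := Metric.continuousWithinAt_iff.1 hc r hr
  have hK : (0 : ℝ) ≤ K := K.2
  refine ⟨min (min r d) ((1 - q) / (2 * (K + 1))),
    lt_min (lt_min hr hd) (div_pos (by linarith) (by linarith)), ?_⟩
  intro a b ha hb hat hbt hab
  have hsub : Icc a b ⊆ Icc 0 T := Icc_subset_Icc ha.1 hb.2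
  have hIB : Icc a b ⊆ Metric.ball t (min (min r d) ((1 - q) / (2 * (K + 1)))) := by
    rw [Real.ball_eq_Ioo] at hat hbt ⊢
    exact Icc_subset_Ioo hat.1 hbt.2
  have hxs : ∀ s ∈ Icc a b, x s ∈ Metric.ball (x t) r := fun s hs => hxd (hsub hs)
    ((hIB hs).trans_le ((min_le_left _ _).trans (min_le_right _ _)))
  have hsr : ∀ s ∈ Icc a b, s ∈ Metric.ball t r := fun s hs =>
    Metric.ball_subset_ball ((min_le_left _ _).trans (min_le_left _ _)) (hIB hs)
  have hprod : ∀ s ∈ Icc a b, ∀ y ∈ Metric.ball (x t) r, (s, y) ∈ Metric.ball (t, x t) r := by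
    intro s hs y hy
    rw [← ball_prod_same]
    exact ⟨hsr s hs, hy⟩
  have ha' := left_mem_Icc.2 hab
  have hb' := right_mem_Icc.2 hab
  have hBV' : BoundedVariationOn x (Icc a b) := hBV.mono hsub
  have hsmall : K * (b - a) + q < 1 := by
    have h1 : b - a < 2 * ((1 - q) / (2 * (K + 1))) := by
      have ha := Metric.ball_subset_ball (min_le_right _ _) hat
      have hb := Metric.ball_subset_ball (min_le_right _ _) hbt
      rw [Real.ball_eq_Ioo] at ha hb
      linarith [ha.1, hb.2]
    have h2 : 2 * ((1 - q) / (2 * (K + 1))) * (K + 1) = 1 - q := by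
      have : (K : ℝ) + 1 ≠ 0 := by positivity
      field_simp
    nlinarith
  have hD : Diss x a b = 0 := by
    refine Diss_eq_zero_of_abs_pEx_le hE hab hBV' hK hq0 (hED a b ha.1 hab hb.2) ?_ ?_ hsmall
    · intro s hs
      have h := hKU.dist_le_mul _ (hball _ (hprod s hs _ (hxs s hs))).1 _
        (hball _ (hprod s hs _ (hxs a ha'))).1
      simpa [Prod.dist_eq, Real.dist_eq] using h
    · intro y hy
      exact (hball _ (hprod b hb' y
        (((convex_ball (x t) r).ordConnected).uIcc_subset (hxs a ha') (hxs b hb') hy))).2.le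
  have h := hBV'.abs_sub_le_Diss ha' hb'
  rw [hD] at h
  exact sub_eq_zero.1 (abs_nonpos_iff.1 h)

theorem abs_pEx_eq_one {E : ℝ → ℝ → ℝ} {x : ℝ → ℝ} {T t : ℝ}
    (hE : ContDiff ℝ 3 (Function.uncurry E)) (hBV : BoundedVariationOn x (Icc 0 T))
    (hWLS : WeakLS E x T) (hED : EDUB E x T) (ht : t ∈ Ioo 0 T)
    (htJ : t ∉ JumpSet x T ∪ interior (NullSet x T ∪ JumpSet x T)) :
    |pEx E t (x t)| = 1 := by
  have htI := Ioo_subset_Icc_self ht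
  have hc : ContinuousWithinAt x (Icc 0 T) t := by
    by_contra h
    exact htJ (Or.inl ⟨htI, h⟩)
  refine (hWLS t htI hc).antisymm (not_lt.1 fun hlt => htJ (Or.inr ?_))
  obtain ⟨ε, hε, hconst⟩ := exists_const_of_abs_pEx_lt_one hE hBV hED hc hlt
  have hopen : IsOpen (Ioo 0 T ∩ Metric.ball t ε) := isOpen_Ioo.inter Metric.isOpen_ball
  refine mem_interior.2 ⟨_, fun s hs => Or.inl ⟨hs.1, ?_⟩, hopen, ht, Metric.mem_ball_self hε⟩
  refine (hasDerivAt_const s (x s)).congr_of_eventuallyEq ?_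
  filter_upwards [hopen.mem_nhds hs] with u hu
  rcases le_total u s with h | h
  · exact hconst u s (Ioo_subset_Icc_self hu.1) (Ioo_subset_Icc_self hs.1) hu.2 hs.2 h
  · exact (hconst s u (Ioo_subset_Icc_self hs.1) (Ioo_subset_Icc_self hu.1) hs.2 hu.2 h).symm

/-- Difference quotients along a level set of a function `F` with `∂F/∂y ≠ 0`. -/
theorem tendsto_div_of_level_set {F : ℝ × ℝ → ℝ} {L : ℝ × ℝ →L[ℝ] ℝ} {t y : ℝ}
    (hF : HasFDerivAt F L (t, y)) (hL : L (0, 1) ≠ 0) {s u : ℕ → ℝ}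
    (hs : Tendsto s atTop (𝓝 t)) (hu : Tendsto u atTop (𝓝 y)) (hst : ∀ n, s n ≠ t)
    (hlevel : ∀ᶠ n in atTop, F (s n, u n) = F (t, y)) :
    Tendsto (fun n => (u n - y) / (s n - t)) atTop (𝓝 (-(L (1, 0) / L (0, 1)))) := by
  have hLapp : ∀ h v : ℝ, L (h, v) = L (1, 0) * h + L (0, 1) * v := by
    intro h v
    have : ((h, v) : ℝ × ℝ) = h • (1, 0) + v • (0, 1) := by simp
    rw [this, map_add, map_smul, map_smul, smul_eq_mul, smul_eq_mul, mul_comm h, mul_comm v]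
  set b := L (1, 0)
  set a := L (0, 1)
  have hw : (fun n => b * (s n - t) + a * (u n - y)) =o[atTop]
      fun n => (s n - t, u n - y) := by
    have h := (hF.isLittleO.comp_tendsto (hs.prodMk_nhds hu)).neg_left
    refine h.congr' ?_ (Eventually.of_forall fun n => by simp)
    filter_upwards [hlevel] with n hn
    simp [hn, hLapp]
  have ha : 0 < |a| := abs_pos.2 hL
  have hO : (fun n => (s n - t, u n - y)) =O[atTop] fun n => s n - t := by
    refine (Asymptotics.isBigO_refl _ _).prod_left
      (Asymptotics.IsBigO.of_bound ((|a| + 2 * |b|) / |a|) ?_)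
    filter_upwards [hw.bound (half_pos ha)] with n hn
    simp only [Real.norm_eq_abs, Prod.norm_def] at hn ⊢
    have h1 : |a * (u n - y)| ≤ |b * (s n - t) + a * (u n - y)| + |b * (s n - t)| := by
      have := abs_sub (b * (s n - t) + a * (u n - y)) (b * (s n - t))
      simpa using this
    rw [abs_mul a, abs_mul b (s n - t)] at h1
    have h2 : max |s n - t| |u n - y| ≤ |s n - t| + |u n - y| :=
      max_le_add_of_nonneg (abs_nonneg _) (abs_nonneg _)
    rw [div_mul_eq_mul_div, le_div_iff₀ ha]
    nlinarith
  have h0 := ((hw.trans_isBigO hO).tendsto_div_nhds_zero.sub_const b).div_const a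
  rw [zero_sub, neg_div] at h0
  refine h0.congr fun n => ?_
  have := sub_ne_zero.2 (hst n)
  field_simp
  ring

/-- if `t ∉ J ∪ int(N ∪ J)` and `∂ₓₓ𝓔(t,x(t)) ≠ 0`, then along every sequence
`tₙ → t` with `tₙ ∉ J ∪ int(N ∪ J)`, `tₙ ≠ t`, the difference quotients converge to
`−∂ₓₜ𝓔(t,x(t))/∂ₓₓ𝓔(t,x(t))`. -/
theorem difference_quotient_limit
    (T : ℝ) (hT : 0 < T) (E : ℝ → ℝ → ℝ)
    (hE : ContDiff ℝ 3 (Function.uncurry E))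
    (x : ℝ → ℝ) (hBV : BoundedVariationOn x (Set.Icc 0 T))
    (hWLS : WeakLS E x T) (hED : EDUB E x T)
    (t : ℝ) (ht : t ∈ Set.Icc 0 T)
    (htJ : t ∉ JumpSet x T ∪ interior (NullSet x T ∪ JumpSet x T))
    (hxx : pExx E t (x t) ≠ 0) :
    ∀ tn : ℕ → ℝ, (∀ n, tn n ∈ Set.Icc 0 T) →
      (∀ n, tn n ∉ JumpSet x T ∪ interior (NullSet x T ∪ JumpSet x T)) →
      (∀ n, tn n ≠ t) →
      Filter.Tendsto tn Filter.atTop (𝓝 t) →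
      Filter.Tendsto (fun n => (x (tn n) - x t) / (tn n - t)) Filter.atTop
        (𝓝 (-(pExt E t (x t) / pExx E t (x t)))) := by
  intro tn htn htnJ hne hlim
  have hcont : ∀ {s}, s ∈ Icc 0 T →
      s ∉ JumpSet x T ∪ interior (NullSet x T ∪ JumpSet x T) →
      ContinuousWithinAt x (Icc 0 T) s := fun hs hsJ =>
    by_contra fun h => hsJ (Or.inl ⟨hs, h⟩)
  have hxlim : Tendsto (fun n => x (tn n)) atTop (𝓝 (x t)) :=
    (hcont ht htJ).tendsto.comp
      (tendsto_nhdsWithin_iff.2 ⟨hlim, Eventually.of_forall htn⟩)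
  have havoid : ∀ c, ∀ᶠ n in atTop, tn n ≠ c := fun c => by
    rcases eq_or_ne t c with rfl | h
    · exact Eventually.of_forall hne
    · exact hlim.eventually_ne h
  have hone : ∀ᶠ n in atTop, |pEx E (tn n) (x (tn n))| = 1 := by
    filter_upwards [havoid 0, havoid T] with n h0 hT'
    exact abs_pEx_eq_one hE hBV hWLS hED
      ⟨(htn n).1.lt_of_ne h0.symm, (htn n).2.lt_of_ne hT'⟩ (htnJ n)
  have hF := contDiff_pEx hE
  have hFlim : Tendsto (fun n => pEx E (tn n) (x (tn n))) atTop (𝓝 (pEx E t (x t))) :=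
    (hF.continuous.tendsto (t, x t)).comp (hlim.prodMk_nhds hxlim)
  have hone' : |pEx E t (x t)| = 1 :=
    tendsto_nhds_unique hFlim.abs (tendsto_const_nhds.congr' (hone.mono fun n hn => hn.symm))
  have hlevel : ∀ᶠ n in atTop, pEx E (tn n) (x (tn n)) = pEx E t (x t) := by
    filter_upwards [hone, Metric.tendsto_nhds.1 hFlim 1 one_pos] with n hn hd
    rw [Real.dist_eq, abs_lt] at hd
    rcases eq_or_eq_neg_of_abs_eq hn with h | h <;>
      rcases eq_or_eq_neg_of_abs_eq hone' with h' | h' <;> rw [h, h'] at hd ⊢ <;> linarith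
  have hdiff : Differentiable ℝ (Function.uncurry (pEx E)) := hF.differentiable (by norm_num)
  have hxx' : pExx E t (x t) = fderiv ℝ (Function.uncurry (pEx E)) (t, x t) (0, 1) :=
    (hasDerivAt_right_of_uncurry hdiff t (x t)).deriv
  have hxt' : pExt E t (x t) = fderiv ℝ (Function.uncurry (pEx E)) (t, x t) (1, 0) :=
    (hasDerivAt_left_of_uncurry hdiff t (x t)).deriv
  rw [hxt', hxx']
  exact tendsto_div_of_level_set (hdiff (t, x t)).hasFDerivAt (hxx' ▸ hxx) hlim hxlim hne hlevel
end

section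
/- Assume the BV function x:[0,T]→ℝ satisfies the weak local stability and the energy-dissipation upper bound. Then for every t∈(0,T)∖J one has limsup_{s→t} { ∂ₓ𝓔(t,x(t)) · (x(s)−x(t))/(s−t) } ≤ 0, where J is the jump set of x. -/
open Set Filter Topology MeasureTheory

theorem continuous_pEx {E : ℝ → ℝ → ℝ} (hE : ContDiff ℝ 1 (Function.uncurry E)) :
    Continuous fun p : ℝ × ℝ => pEx E p.1 p.2 := by
  have h : (fun p : ℝ × ℝ => pEx E p.1 p.2)
      = fun p => fderiv ℝ (Function.uncurry E) p (0, 1) := by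
    ext p
    have h1 : HasDerivAt (fun z : ℝ => (p.1, z)) ((0 : ℝ), (1 : ℝ)) p.2 :=
      (hasDerivAt_const _ _).prodMk (hasDerivAt_id _)
    exact ((hE.differentiable one_ne_zero p).hasFDerivAt.comp_hasDerivAt p.2 h1).deriv
  rw [h]
  exact (hE.continuous_fderiv one_ne_zero).clm_apply continuous_const

theorem continuous_pEt {E : ℝ → ℝ → ℝ} (hE : ContDiff ℝ 1 (Function.uncurry E)) :
    Continuous fun p : ℝ × ℝ => pEt E p.1 p.2 := by
  have h : (fun p : ℝ × ℝ => pEt E p.1 p.2)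
      = fun p => fderiv ℝ (Function.uncurry E) p (1, 0) := by
    ext p
    have h1 : HasDerivAt (fun s : ℝ => (s, p.2)) ((1 : ℝ), (0 : ℝ)) p.1 :=
      (hasDerivAt_id _).prodMk (hasDerivAt_const _ _)
    exact ((hE.differentiable one_ne_zero p).hasFDerivAt.comp_hasDerivAt p.1 h1).deriv
  rw [h]
  exact (hE.continuous_fderiv one_ne_zero).clm_apply continuous_const

theorem BoundedVariationOn.aemeasurable_restrict {x : ℝ → ℝ} {s : Set ℝ}
    (hx : BoundedVariationOn x s) (hs : MeasurableSet s) :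
    AEMeasurable x (volume.restrict s) := by
  obtain ⟨p, q, hp, hq, rfl⟩ :=
    hx.locallyBoundedVariationOn.exists_monotoneOn_sub_monotoneOn
  exact (aemeasurable_restrict_of_monotoneOn hs hp).sub
    (aemeasurable_restrict_of_monotoneOn hs hq)

theorem BoundedVariationOn.intervalIntegrable_comp {x : ℝ → ℝ} {g : ℝ × ℝ → ℝ}
    (hg : Continuous g) {u v : ℝ} (huv : u ≤ v) (hx : BoundedVariationOn x (Icc u v)) :
    IntervalIntegrable (fun r => g (r, x r)) volume u v := by
  rw [intervalIntegrable_iff_integrableOn_Icc_of_le huv]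
  have hm : AEMeasurable (fun r => g (r, x r)) (volume.restrict (Icc u v)) :=
    hg.measurable.comp_aemeasurable
      (aemeasurable_id.prodMk (hx.aemeasurable_restrict measurableSet_Icc))
  obtain ⟨C, hC⟩ := (isCompact_Icc.prod
    (isCompact_closedBall (x u) (eVariationOn x (Icc u v)).toReal)).exists_bound_of_continuousOn
    hg.continuousOn
  refine IntegrableOn.of_bound (C := C) (by simp) hm.aestronglyMeasurable ?_
  refine (ae_restrict_iff' measurableSet_Icc).2 (.of_forall fun r hr => hC _ ⟨hr, ?_⟩)
  exact hx.dist_le hr (left_mem_Icc.2 huv)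

/-- Comparison of the energy along `x` with the energy along a constant path. -/
theorem EDUB.sub_add_abs_le {E : ℝ → ℝ → ℝ} {x : ℝ → ℝ} {T : ℝ} (hED : EDUB E x T)
    (hE : ContDiff ℝ 1 (Function.uncurry E)) (hBV : BoundedVariationOn x (Icc 0 T))
    {u v : ℝ} (hu : 0 ≤ u) (huv : u ≤ v) (hv : v ≤ T) {c η : ℝ}
    (hη : ∀ r ∈ Icc u v, |pEt E r (x r) - pEt E r c| ≤ η) :
    E v (x v) - E u (x u) + |x v - x u| ≤ E v c - E u c + η * (v - u) := by
  have hx : BoundedVariationOn x (Icc u v) := hBV.mono (Icc_subset_Icc hu hv)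
  have hcont := continuous_pEt hE
  have hint := hx.intervalIntegrable_comp hcont huv
  have hintc : IntervalIntegrable (fun r => pEt E r c) volume u v :=
    (hcont.comp (continuous_id.prodMk continuous_const)).intervalIntegrable u v
  have hdiss : |x v - x u| ≤ Diss x u v :=
    hx.dist_le (right_mem_Icc.2 huv) (left_mem_Icc.2 huv)
  have hftc : ∫ r in u..v, pEt E r c = E v c - E u c := by
    refine intervalIntegral.integral_deriv_eq_sub' (fun s => E s c) rfl (fun r _ => ?_) ?_
    · exact (hE.differentiable one_ne_zero).comp
        (differentiable_id.prodMk (differentiable_const c)) r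
    · exact (hcont.comp (continuous_id.prodMk continuous_const)).continuousOn
  have hdiff : (∫ r in u..v, pEt E r (x r)) - ∫ r in u..v, pEt E r c ≤ η * (v - u) := by
    rw [← intervalIntegral.integral_sub hint hintc]
    refine (le_abs_self _).trans ?_
    rw [← abs_of_nonneg (sub_nonneg.2 huv)]
    have hbound : ∀ r ∈ uIoc u v, ‖pEt E r (x r) - pEt E r c‖ ≤ η := fun r hr => by
      rw [uIoc_of_le huv] at hr
      exact hη r (Ioc_subset_Icc_self hr)
    exact intervalIntegral.norm_integral_le_of_norm_le_const hbound
  linarith [hED u v hu huv hv]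

/-- Joint first-order expansion of `E` in its second variable. -/
theorem eventually_abs_sub_sub_le {E : ℝ → ℝ → ℝ} (hE : ContDiff ℝ 1 (Function.uncurry E))
    (t c : ℝ) {η : ℝ} (hη : 0 < η) :
    ∀ᶠ p : ℝ × ℝ in 𝓝 (t, c), |E p.1 p.2 - E p.1 c - pEx E t c * (p.2 - c)| ≤ η * |p.2 - c| := by
  have hev := Metric.tendsto_nhds.1 ((continuous_pEx hE).tendsto (t, c)) η hη
  obtain ⟨ρ, hρ, hball⟩ := Metric.eventually_nhds_iff_ball.1 hev
  filter_upwards [Metric.ball_mem_nhds _ hρ] with p hp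
  rw [← ball_prod_same] at hp hball
  have hd : ∀ z ∈ Metric.ball c ρ, HasDerivWithinAt (fun z => E p.1 z - pEx E t c * z)
      (pEx E p.1 z - pEx E t c) (Metric.ball c ρ) z := fun z _ => by
    have h1 : DifferentiableAt ℝ (fun z => E p.1 z) z :=
      (hE.differentiable one_ne_zero).comp
        ((differentiable_const p.1).prodMk differentiable_id) z
    have h2 : HasDerivAt (fun z => pEx E t c * z) (pEx E t c) z := by
      simpa using (hasDerivAt_id z).const_mul (pEx E t c)
    exact (h1.hasDerivAt.sub h2).hasDerivWithinAt
  have h := (convex_ball c ρ).norm_image_sub_le_of_norm_hasDerivWithin_le hd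
    (fun z hz => (hball (p.1, z) ⟨hp.1, hz⟩).le) (Metric.mem_ball_self hρ) hp.2
  rw [Real.norm_eq_abs, Real.norm_eq_abs] at h
  convert h using 2
  ring

/-- under weak local stability and the energy-dissipation upper bound, for every
non-jump point `t ∈ (0,T)`,  `limsup_{s→t} ∂ₓ𝓔(t,x(t))·(x(s)−x(t))/(s−t) ≤ 0`, i.e. for
every `ε > 0` the quantity is eventually `< ε` as `s → t`, `s ≠ t`. -/
theorem limsup_slope_nonpos
    (T : ℝ) (hT : 0 < T) (E : ℝ → ℝ → ℝ)
    (hE : ContDiff ℝ 3 (Function.uncurry E))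
    (x : ℝ → ℝ) (hBV : BoundedVariationOn x (Set.Icc 0 T))
    (hWLS : WeakLS E x T) (hED : EDUB E x T) :
    ∀ t ∈ Set.Ioo 0 T \ JumpSet x T, ∀ ε > (0:ℝ),
      ∀ᶠ s in 𝓝[≠] t, pEx E t (x t) * ((x s - x t) / (s - t)) < ε := by
  rintro t ⟨ht, htJ⟩ ε hε
  have htI : t ∈ Icc 0 T := Ioo_subset_Icc_self ht
  have hcw : ContinuousWithinAt x (Icc 0 T) t := by
    by_contra h
    exact htJ ⟨htI, h⟩
  have hcx : ContinuousAt x t := hcw.continuousAt (Icc_mem_nhds ht.1 ht.2)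
  have ha : |pEx E t (x t)| ≤ 1 := hWLS t htI hcw
  have hE1 : ContDiff ℝ 1 (Function.uncurry E) := hE.of_le (by norm_num)
  obtain ⟨η, hη, hη2, hηε⟩ : ∃ η : ℝ, 0 < η ∧ η ≤ 1 / 2 ∧ 2 * η < ε :=
    ⟨min (1 / 2) (ε / 3), by positivity, min_le_left _ _, by
      linarith [min_le_right (1 / 2 : ℝ) (ε / 3)]⟩
  have hpair : Tendsto (fun r => (r, x r)) (𝓝 t) (𝓝 (t, x t)) := tendsto_id.prodMk_nhds hcx
  have hexp := hpair.eventually (eventually_abs_sub_sub_le hE1 t (x t) hη)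
  have hpt : ∀ᶠ r in 𝓝 t, |pEt E r (x r) - pEt E r (x t)| < η := by
    have h1 := ((continuous_pEt hE1).tendsto (t, x t)).comp hpair
    have h2 := ((continuous_pEt hE1).tendsto (t, x t)).comp
      (tendsto_id.prodMk_nhds (tendsto_const_nhds (x := x t)))
    have h := (h1.sub h2).abs
    simp only [sub_self, abs_zero] at h
    exact h.eventually_lt_const hη
  obtain ⟨ρ, hρ, hball⟩ := Metric.eventually_nhds_iff_ball.1
    (hpt.and (Icc_mem_nhds ht.1 ht.2))
  filter_upwards [nhdsWithin_le_nhds hexp, nhdsWithin_le_nhds (Metric.ball_mem_nhds t hρ),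
    self_mem_nhdsWithin] with s hs hsρ hne
  have hsub : uIcc t s ⊆ Metric.ball t ρ := by
    rw [Real.ball_eq_Ioo] at hsρ ⊢
    exact ordConnected_Ioo.uIcc_subset ⟨by linarith, by linarith⟩ hsρ
  have hsT := (hball s hsρ).2
  obtain ⟨hs1, hs2⟩ := abs_le.1 hs
  have hδ : |pEx E t (x t) * (x s - x t)| ≤ |x s - x t| := by
    rw [abs_mul]
    exact mul_le_of_le_one_left (abs_nonneg _) ha
  have hηδ : η * |x s - x t| ≤ 1 / 2 * |x s - x t| := by gcongr
  obtain ⟨hδ1, hδ2⟩ := abs_le.1 hδ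
  rw [← mul_div_assoc]
  rcases lt_or_gt_of_ne hne with hlt | hgt
  · have key := hED.sub_add_abs_le hE1 hBV hsT.1 hlt.le htI.2 (c := x t) (η := η)
      fun r hr => (hball r (hsub (Icc_subset_uIcc' hr))).1.le
    rw [abs_sub_comm (x t)] at key
    rw [div_lt_iff_of_neg (sub_neg.2 hlt)]
    nlinarith
  · have key := hED.sub_add_abs_le hE1 hBV htI.1 hgt.le hsT.2 (c := x t) (η := η)
      fun r hr => (hball r (hsub (Icc_subset_uIcc hr))).1.le
    rw [div_lt_iff₀ (sub_pos.2 hgt)]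
    nlinarith
end

section
/- Assume the BV function x:[0,T]→ℝ is continuous and satisfies the strong local stability and the energy-dissipation upper bound. Let t ∈ int([0,T]∖int(N)) be such that ∂ₓₓ𝓔(t,x(t)) = 0 and ∂ₓₓₓ𝓔(t,x(t)) ≠ 0. Then ∂ₓₜ𝓔(t,x(t)) = 0. -/
open Set Filter Topology MeasureTheory

/-- The partial derivative in the second variable of a `C^(n+1)` function is `C^n`. -/
theorem contDiff_uncurry_deriv_snd {n m : WithTop ℕ∞} {G : ℝ → ℝ → ℝ}
    (hG : ContDiff ℝ n (Function.uncurry G)) (hmn : m + 1 ≤ n) :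
    ContDiff ℝ m (Function.uncurry fun t y => deriv (fun z => G t z) y) := by
  have hn : n ≠ 0 := by
    rintro rfl
    simp at hmn
  have h : (Function.uncurry fun t y => deriv (fun z => G t z) y)
      = fun p => fderiv ℝ (Function.uncurry G) p (0, 1) := by
    ext ⟨t, y⟩
    exact HasDerivAt.deriv (((hG.differentiable hn (t, y)).hasFDerivAt).comp_hasDerivAt y
      ((hasDerivAt_const y t).prodMk (hasDerivAt_id y)))
  rw [h]
  exact (hG.fderiv_right hmn).clm_apply contDiff_const

/-- The partial derivative in the first variable, in terms of the total derivative. -/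
theorem hasDerivAt_fst_of_hasFDerivAt_uncurry {G : ℝ → ℝ → ℝ} {G' : ℝ × ℝ →L[ℝ] ℝ} {t y : ℝ}
    (h : HasFDerivAt (Function.uncurry G) G' (t, y)) :
    HasDerivAt (fun s => G s y) (G' (1, 0)) t :=
  HasFDerivAt.comp_hasDerivAt (f := fun s => (s, y)) t h
    ((hasDerivAt_id' t).prodMk (hasDerivAt_const t y))

/-- The partial derivative in the first variable of a `C^(n+1)` function is `C^n`. -/
theorem contDiff_uncurry_deriv_fst {n m : WithTop ℕ∞} {G : ℝ → ℝ → ℝ}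
    (hG : ContDiff ℝ n (Function.uncurry G)) (hmn : m + 1 ≤ n) :
    ContDiff ℝ m (Function.uncurry fun t y => deriv (fun s => G s y) t) := by
  have hn : n ≠ 0 := by
    rintro rfl
    simp at hmn
  have h : (Function.uncurry fun t y => deriv (fun s => G s y) t)
      = fun p => fderiv ℝ (Function.uncurry G) p (1, 0) := by
    ext ⟨t, y⟩
    exact (hasDerivAt_fst_of_hasFDerivAt_uncurry (hG.differentiable hn (t, y)).hasFDerivAt).deriv
  rw [h]
  exact (hG.fderiv_right hmn).clm_apply contDiff_const

/-- If `G` is constant along a curve `s ↦ (s, x s)` and `G t` has a nondegenerate critical point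
at `x t`, then the first partial derivative of `G` vanishes at `(t, x t)`. -/
theorem deriv_fst_eq_zero_of_const_on_curve {G : ℝ → ℝ → ℝ} {x : ℝ → ℝ} {t : ℝ}
    (hG : ContDiff ℝ 1 (Function.uncurry G)) (hx : ContinuousAt x t)
    (hconst : ∀ᶠ s in 𝓝 t, G s (x s) = G t (x t))
    (h1 : deriv (G t) (x t) = 0) (h2 : deriv (deriv (G t)) (x t) ≠ 0) :
    deriv (fun s => G s (x t)) t = 0 := by
  have hGt : ContinuousAt (G t) (x t) :=
    (hG.continuous.comp (Continuous.prodMk_right t)).continuousAt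
  have hextr : IsLocalExtr (G t) (x t) := by
    rcases lt_or_gt_of_ne h2 with h | h
    · exact Or.inr (isLocalMax_of_deriv_deriv_neg h h1 hGt)
    · exact Or.inl (isLocalMin_of_deriv_deriv_pos h h1 hGt)
  have hstrict : HasStrictFDerivAt (Function.uncurry G)
      (fderiv ℝ (Function.uncurry G) (t, x t)) (t, x t) :=
    hG.contDiffAt.hasStrictFDerivAt (by norm_num)
  have hderiv : deriv (fun s => G s (x t)) t = fderiv ℝ (Function.uncurry G) (t, x t) (1, 0) :=
    (hasDerivAt_fst_of_hasFDerivAt_uncurry hstrict.hasFDerivAt).deriv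
  have hdiff : HasDerivAt (fun s => G s (x s) - G t (x s))
      (fderiv ℝ (Function.uncurry G) (t, x t) (1, 0)) t := by
    rw [hasDerivAt_iff_isLittleO]
    have hpath : Tendsto (fun s => ((s, x s), (t, x s))) (𝓝 t) (𝓝 ((t, x t), (t, x t))) :=
      (continuousAt_id.prodMk hx).prodMk (continuousAt_const.prodMk hx)
    have ho := hstrict.isLittleO.comp_tendsto hpath
    have hO : (fun s => (s, x s) - (t, x s)) =O[𝓝 t] fun s => s - t :=
      Asymptotics.isBigO_of_le _ fun s => by simp [Prod.norm_def]
    refine (ho.trans_isBigO hO).congr_left fun s => ?_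
    have hv : ((s, x s) - (t, x s) : ℝ × ℝ) = (s - t) • ((1 : ℝ), (0 : ℝ)) := by simp
    simp only [Function.comp_apply, hv, map_smul, Function.uncurry_apply_pair, sub_self, sub_zero]
  have hcomp : IsLocalExtr (fun s => G t (x t) - G t (x s)) t := by
    rcases hextr with h | h
    · exact Or.inr ((hx.eventually h).mono fun s hs => by simpa using hs)
    · exact Or.inl ((hx.eventually h).mono fun s hs => by simpa using hs)
  rw [hderiv]
  refine hcomp.hasDerivAt_eq_zero (hdiff.congr_of_eventuallyEq ?_)
  filter_upwards [hconst] with s hs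
  rw [hs]

/-- First order condition for a local minimizer of `z ↦ f z + |z - y|` at `y`. -/
theorem abs_deriv_le_one_of_isLocalMin_add_abs {f : ℝ → ℝ} {y : ℝ} (hf : DifferentiableAt ℝ f y)
    (h : IsLocalMin (fun z => f z + |z - y|) y) : |deriv f y| ≤ 1 := by
  have hs := hasDerivAt_iff_tendsto_slope.1 hf.hasDerivAt
  have hm : ∀ᶠ z in 𝓝 y, f y ≤ f z + |z - y| := by
    filter_upwards [h] with z hz
    simpa using hz
  rw [abs_le]
  constructor
  · refine ge_of_tendsto (hs.mono_left (nhdsWithin_mono y fun z (hz : z ∈ Ioi y) => hz.ne')) ?_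
    filter_upwards [nhdsWithin_le_nhds hm, self_mem_nhdsWithin] with z hz (hyz : y < z)
    rw [abs_of_pos (sub_pos.2 hyz)] at hz
    rw [slope_def_field, le_div_iff₀ (sub_pos.2 hyz)]
    linarith
  · refine le_of_tendsto (hs.mono_left (nhdsWithin_mono y fun z (hz : z ∈ Iio y) => hz.ne)) ?_
    filter_upwards [nhdsWithin_le_nhds hm, self_mem_nhdsWithin] with z hz (hyz : z < y)
    rw [abs_of_neg (sub_neg.2 hyz)] at hz
    rw [slope_def_field, div_le_iff_of_neg (sub_neg.2 hyz)]
    linarith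

/-- The increments of a function of bounded variation are bounded by its dissipation. -/
theorem abs_sub_le_diss {x : ℝ → ℝ} {a b r s : ℝ} (h : BoundedVariationOn x (Icc a b))
    (hr : r ∈ Icc a b) (hs : s ∈ Icc a b) : |x r - x s| ≤ Diss x a b := by
  simpa [Real.dist_eq, Diss] using h.dist_le hr hs

/-- If the energy is `c`-Lipschitz and its power `K`-Lipschitz in the state variable along `x` on
`[a, b]`, where `c + K (b - a) < 1`, then the energy-dissipation upper bound forces the
dissipation on `[a, b]` to vanish. -/
theorem diss_eq_zero_of_lipschitz {E : ℝ → ℝ → ℝ} {x : ℝ → ℝ} {a b c K : ℝ}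
    (hE : ContDiff ℝ 2 (Function.uncurry E)) (hab : a ≤ b)
    (hBV : BoundedVariationOn x (Icc a b)) (hcont : ContinuousOn x (Icc a b))
    (hED : E b (x b) - E a (x a) ≤ (∫ s in a..b, pEt E s (x s)) - Diss x a b)
    (hc : 0 ≤ c) (hLip : |E b (x b) - E b (x a)| ≤ c * |x b - x a|)
    (hK : 0 ≤ K) (hpower : ∀ r ∈ Icc a b, |pEt E r (x r) - pEt E r (x a)| ≤ K * |x r - x a|)
    (hsmall : c + K * (b - a) < 1) : Diss x a b = 0 := by
  have hEt : Continuous (Function.uncurry (pEt E)) :=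
    (contDiff_uncurry_deriv_fst (m := 1) hE (by norm_num)).continuous
  have hD : 0 ≤ Diss x a b := ENNReal.toReal_nonneg
  have hfix : ∫ s in a..b, pEt E s (x a) = E b (x a) - E a (x a) := by
    have hEx : ∀ s, HasDerivAt (fun r => E r (x a)) (pEt E s (x a)) s := fun s =>
      DifferentiableAt.hasDerivAt
        ((hE.comp (contDiff_id.prodMk contDiff_const)).differentiable (by norm_num) s)
    exact intervalIntegral.integral_eq_sub_of_hasDerivAt (fun s _ => hEx s)
      ((hEt.comp (continuous_id.prodMk continuous_const)).intervalIntegrable a b)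
  have hint1 : IntervalIntegrable (fun s => pEt E s (x s)) volume a b := by
    refine ContinuousOn.intervalIntegrable ?_
    rw [uIcc_of_le hab]
    exact hEt.comp_continuousOn (continuousOn_id.prodMk hcont)
  have hint2 : IntervalIntegrable (fun s => pEt E s (x a)) volume a b :=
    (hEt.comp (continuous_id.prodMk continuous_const)).intervalIntegrable a b
  have hpow : |∫ s in a..b, (pEt E s (x s) - pEt E s (x a))| ≤ K * Diss x a b * (b - a) := by
    have := intervalIntegral.norm_integral_le_of_norm_le_const (a := a) (b := b)
      (f := fun s => pEt E s (x s) - pEt E s (x a)) (C := K * Diss x a b) fun r hr => by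
        rw [uIoc_of_le hab] at hr
        have hr' : r ∈ Icc a b := Ioc_subset_Icc_self hr
        exact (hpower r hr').trans (mul_le_mul_of_nonneg_left
          (abs_sub_le_diss hBV hr' (left_mem_Icc.2 hab)) hK)
    rwa [abs_of_nonneg (sub_nonneg.2 hab)] at this
  rw [intervalIntegral.integral_sub hint1 hint2, hfix] at hpow
  have hinc : c * |x b - x a| ≤ c * Diss x a b := mul_le_mul_of_nonneg_left
    (abs_sub_le_diss hBV (right_mem_Icc.2 hab) (left_mem_Icc.2 hab)) hc
  have h1 := (abs_le.1 hLip).1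
  have h2 := (abs_le.1 hpow).2
  have : (1 - (c + K * (b - a))) * Diss x a b ≤ 0 := by linarith
  nlinarith

/-- Where the slope of the energy is strictly below the dissipation threshold, `x` is locally
constant. -/
theorem eventually_eq_of_abs_pEx_lt_one {T : ℝ} {E : ℝ → ℝ → ℝ} {x : ℝ → ℝ} {s : ℝ}
    (hE : ContDiff ℝ 2 (Function.uncurry E)) (hBV : BoundedVariationOn x (Icc 0 T))
    (hcont : ContinuousOn x (Icc 0 T)) (hED : EDUB E x T) (hs : s ∈ Ioo 0 T)
    (hlt : |pEx E s (x s)| < 1) : ∀ᶠ r in 𝓝 s, x r = x s := by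
  have hEx : Continuous (Function.uncurry (pEx E)) :=
    (contDiff_uncurry_deriv_snd (m := 1) hE (by norm_num)).continuous
  have hEt : ContDiff ℝ 1 (Function.uncurry (pEt E)) :=
    contDiff_uncurry_deriv_fst hE (by norm_num)
  obtain ⟨c, hc, hc1⟩ := exists_between hlt
  have hc0 : 0 ≤ c := (abs_nonneg _).trans hc.le
  obtain ⟨K, U, hU, hKU⟩ := hEt.contDiffAt.exists_lipschitzOnWith (x := (s, x s))
  have hV : {p : ℝ × ℝ | |Function.uncurry (pEx E) p| ≤ c} ∈ 𝓝 (s, x s) := by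
    filter_upwards [hEx.abs.continuousAt.tendsto.eventually_lt_const hc] with p hp
    exact le_of_lt hp
  obtain ⟨ε, hε, hball⟩ := Metric.mem_nhds_iff.1 (inter_mem hU hV)
  have hxs : ContinuousAt x s := hcont.continuousAt (Icc_mem_nhds hs.1 hs.2)
  obtain ⟨d, hd, hd'⟩ := Metric.mem_nhds_iff.1 (inter_mem (Ioo_mem_nhds hs.1 hs.2)
    (inter_mem (Metric.ball_mem_nhds s hε) (hxs (Metric.ball_mem_nhds (x s) hε))))
  obtain ⟨δ, hδ, hδd, hδK⟩ : ∃ δ > 0, δ < d ∧ c + K * (2 * δ) < 1 := by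
    have h1 : ∀ᶠ δ : ℝ in 𝓝[>] 0, δ < d := nhdsWithin_le_nhds (eventually_lt_nhds hd)
    have h2 : ∀ᶠ δ : ℝ in 𝓝[>] 0, c + K * (2 * δ) < 1 := by
      have hlin : ContinuousAt (fun δ : ℝ => c + K * (2 * δ)) 0 := by fun_prop
      exact nhdsWithin_le_nhds (hlin.tendsto.eventually_lt_const (by simpa using hc1))
    exact (eventually_mem_nhdsWithin.and (h1.and h2)).exists
  have hsub : ∀ r ∈ Icc (s - δ) (s + δ),
      r ∈ Ioo 0 T ∧ r ∈ Metric.ball s ε ∧ x r ∈ Metric.ball (x s) ε := fun r hr => by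
    refine hd' ?_
    rw [Metric.mem_ball, Real.dist_eq, abs_lt]
    constructor <;> linarith [hr.1, hr.2]
  have hsubT : Icc (s - δ) (s + δ) ⊆ Icc 0 T := fun r hr => Ioo_subset_Icc_self (hsub r hr).1
  have hab : s - δ ≤ s + δ := by linarith
  have ha := left_mem_Icc.2 hab
  have hb := right_mem_Icc.2 hab
  have hmem : ∀ r ∈ Icc (s - δ) (s + δ), ∀ y ∈ Metric.ball (x s) ε,
      (r, y) ∈ U ∧ |pEx E r y| ≤ c := fun r hr y hy => by
    have : (r, y) ∈ Metric.ball (s, x s) ε := by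
      rw [← ball_prod_same]
      exact ⟨(hsub r hr).2.1, hy⟩
    exact hball this
  have hBV' := hBV.mono hsubT
  have hzero : Diss x (s - δ) (s + δ) = 0 := by
    refine diss_eq_zero_of_lipschitz hE hab hBV' (hcont.mono hsubT)
      (hED _ _ (hsubT ha).1 hab (hsubT hb).2) hc0 ?_ K.2 ?_ ?_
    · exact (convex_ball (x s) ε).norm_image_sub_le_of_norm_deriv_le
        (f := fun z => E (s + δ) z)
        (fun y _ => (hE.comp (contDiff_const.prodMk contDiff_id)).differentiable (by norm_num) y)
        (fun y hy => (hmem _ hb y hy).2) (hsub _ ha).2.2 (hsub _ hb).2.2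
    · intro r hr
      have := hKU.dist_le_mul _ (hmem r hr _ (hsub r hr).2.2).1 _ (hmem r hr _ (hsub _ ha).2.2).1
      simpa [Prod.dist_eq, Real.dist_eq] using this
    · have : s + δ - (s - δ) = 2 * δ := by ring
      rw [this]
      exact hδK
  filter_upwards [Icc_mem_nhds (show s - δ < s by linarith) (show s < s + δ by linarith)] with r hr
  have := abs_sub_le_diss hBV' hr (show s ∈ Icc (s - δ) (s + δ) from
    ⟨by linarith, by linarith⟩)
  rw [hzero] at this
  exact sub_eq_zero.1 (abs_nonpos_iff.1 this)

/-- for continuous `x` with strong local stability and the energy-dissipation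
upper bound, if `t ∈ int([0,T] ∖ int(N))`, `∂ₓₓ𝓔(t,x(t)) = 0` and `∂ₓₓₓ𝓔(t,x(t)) ≠ 0`,
then `∂ₓₜ𝓔(t,x(t)) = 0`. -/
theorem mixed_derivative_vanishes
    (T : ℝ) (hT : 0 < T) (E : ℝ → ℝ → ℝ)
    (hE : ContDiff ℝ 3 (Function.uncurry E))
    (x : ℝ → ℝ) (hBV : BoundedVariationOn x (Set.Icc 0 T))
    (hcont : ContinuousOn x (Set.Icc 0 T))
    (hSLS : ∀ t ∈ Set.Icc 0 T, IsLocalMin (fun z => E t z + |z - x t|) (x t))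
    (hED : EDUB E x T)
    (t : ℝ) (ht : t ∈ interior (Set.Icc 0 T \ interior (NullSet x T)))
    (h1 : pExx E t (x t) = 0) (h2 : pExxx E t (x t) ≠ 0) :
    pExt E t (x t) = 0 := by
  have hEx : ContDiff ℝ 2 (Function.uncurry (pEx E)) :=
    contDiff_uncurry_deriv_snd hE (by norm_num)
  have hE2 : ContDiff ℝ 2 (Function.uncurry E) := hE.of_le (by norm_num)
  have htI : t ∈ Ioo 0 T := by
    rw [← interior_Icc]
    exact interior_mono sdiff_subset ht
  have hxt : ContinuousAt x t := hcont.continuousAt (Icc_mem_nhds htI.1 htI.2)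
  have habs : ∀ᶠ s in 𝓝 t, |pEx E s (x s)| = 1 := by
    filter_upwards [Ioo_mem_nhds htI.1 htI.2, mem_interior_iff_mem_nhds.1 ht] with s hs hsN
    refine le_antisymm (abs_deriv_le_one_of_isLocalMin_add_abs
      ((hE.comp (contDiff_const.prodMk contDiff_id)).differentiable (by norm_num) _)
      (hSLS s hsN.1)) (not_lt.1 fun hlt => hsN.2 ?_)
    have hloc := eventually_eq_of_abs_pEx_lt_one hE2 hBV hcont hED hs hlt
    rw [mem_interior_iff_mem_nhds]
    filter_upwards [Ioo_mem_nhds hs.1 hs.2, hloc.eventually_nhds] with r hr hr'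
    exact ⟨hr, (hasDerivAt_const r (x s)).congr_of_eventuallyEq hr'⟩
  have hcurve : ContinuousAt (fun s => pEx E s (x s)) t :=
    ContinuousAt.comp (g := Function.uncurry (pEx E)) hEx.continuous.continuousAt
      (continuousAt_id.prodMk hxt)
  refine deriv_fst_eq_zero_of_const_on_curve (hEx.of_le (by norm_num)) hxt ?_ h1 h2
  filter_upwards [habs, hcurve (Metric.ball_mem_nhds _ one_pos)] with s hs hst
  have hst' : |pEx E s (x s) - pEx E t (x t)| < 1 := hst
  have hone : |pEx E t (x t)| = 1 := habs.self_of_nhds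
  rw [abs_lt] at hst'
  rcases eq_or_eq_neg_of_abs_eq hs with h | h <;>
    rcases eq_or_eq_neg_of_abs_eq hone with h' | h' <;> linarith [hst'.1, hst'.2]
end
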